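/- arXiv:2509.23086 — 7 statements merged into one kernel-verified Lean document; each statement's English description precedes it below -/
import Mathlib

section
/- Let μ, ν ∈ Λ(ℝ^d), γ ∈ Γ^Λ(μ,ν), and let f : ℝ^d → ℝ be Borel measurable with positive part f⁺ ∈ L¹(μ). Then the function (x,y) ↦ f⁺(x) is γ-integrable on ℝ^{2d}, and ∫_{ℝ^{2d}} f(x) dγ(x,y) = ∫_{ℝ^d} f dμ, where both integrals are understood to take values in [−∞, ∞). -/
open MeasureTheory Filter Topology Set ENNReal

noncomputable section

abbrev Ed (d : ℕ) : Type := EuclideanSpace ℝ (Fin d)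

/-- A Lévy measure on a normed space: it assigns zero mass to `{0}` and
integrates `min {1, ‖x‖²}`. -/
def IsLevyMeasure {E : Type*} [NormedAddCommGroup E] [MeasurableSpace E]
    (μ : Measure E) : Prop :=
  μ {0} = 0 ∧ (∫⁻ x, ENNReal.ofReal (min 1 (‖x‖ ^ 2)) ∂μ) ≠ ⊤

/-- Finite (global) second moment. -/
def HasFiniteSecondMoment {E : Type*} [NormedAddCommGroup E] [MeasurableSpace E]
    (μ : Measure E) : Prop :=
  (∫⁻ x, ENNReal.ofReal (‖x‖ ^ 2) ∂μ) ≠ ⊤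

/-- A Lévy coupling of `μ` and `ν`: a Lévy measure on the product whose marginals
agree with `μ`, `ν` on all measurable sets not containing a neighbourhood of `0`. -/
def IsLevyCoupling {E : Type*} [NormedAddCommGroup E] [MeasurableSpace E]
    (μ ν : Measure E) (γ : Measure (E × E)) : Prop :=
  IsLevyMeasure γ ∧
    ∀ s : Set E, MeasurableSet s → s ∉ nhds (0 : E) →
      γ (s ×ˢ (univ : Set E)) = μ s ∧ γ ((univ : Set E) ×ˢ s) = ν s

/-- The 2-optimal Lévy transport cost `C₂^Λ(μ,ν)`. -/
noncomputable def levyTransportCost {E : Type*} [NormedAddCommGroup E] [MeasurableSpace E]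
    (μ ν : Measure E) : ℝ≥0∞ :=
  ⨅ (γ : Measure (E × E)) (_ : IsLevyCoupling μ ν γ),
    ∫⁻ p, ENNReal.ofReal (‖p.1 - p.2‖ ^ 2 / 2) ∂γ

/-- The first marginal of a Lévy coupling agrees with `μ` on every measurable set: sets avoiding `0`
are never neighbourhoods of `0`, and neither measure charges `0`. -/
theorem IsLevyCoupling.map_fst {E : Type*} [NormedAddCommGroup E] [NormedSpace ℝ E]
    [MeasurableSpace E] [MeasurableSingletonClass E] {μ ν : Measure E} {γ : Measure (E × E)}
    (hμ : IsLevyMeasure μ) (hγ : IsLevyCoupling μ ν γ) : γ.map Prod.fst = μ := by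
  have map_fst_apply (s : Set E) (hs : MeasurableSet s) :
      γ.map Prod.fst s = γ (s ×ˢ univ) := by
    rw [Measure.map_apply measurable_fst hs, prod_univ]
  have map_fst_zero : γ.map Prod.fst {0} = 0 := by
    rw [map_fst_apply _ (measurableSet_singleton 0)]
    rcases subsingleton_or_nontrivial E with hE | hE
    · exact measure_mono_null (fun p _ => Subsingleton.elim p 0) hγ.1.1
    · have h_nhds : ({0} : Set E) ∉ 𝓝 0 := fun h => by
        have : (𝓝[≠] (0 : E)).NeBot := Module.punctured_nhds_neBot ℝ E 0
        exact NeBot.ne this (empty_mem_iff_bot.1 <| mem_nhdsWithin_iff_exists_mem_nhds_inter.2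
          ⟨{0}, h, fun x hx => hx.2 hx.1⟩)
      rw [(hγ.2 {0} (measurableSet_singleton 0) h_nhds).1, hμ.1]
  ext s hs
  have hs' : MeasurableSet (s \ {0}) := hs.diff (measurableSet_singleton 0)
  rw [← measure_sdiff_null map_fst_zero, ← measure_sdiff_null (μ := μ) hμ.1, map_fst_apply _ hs']
  exact (hγ.2 _ hs' fun h => (mem_of_mem_nhds h).2 rfl).1

/-- If `γ ∈ Γ^Λ(μ,ν)` and `f : ℝ^d → ℝ` is Borel measurable with
positive part `f⁺ ∈ L¹(μ)`, then `(x,y) ↦ f⁺(x)` is `γ`-integrable and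
`∫ f(x) dγ(x,y) = ∫ f dμ` as integrals with values in `[-∞,∞)` (equality of
positive parts — which are finite — and of negative parts — possibly infinite). -/
theorem levyCoupling_first_marginal_integral (d : ℕ)
    (μ ν : Measure (Ed d)) (γ : Measure (Ed d × Ed d))
    (hμ : IsLevyMeasure μ) (hν : IsLevyMeasure ν)
    (hγ : IsLevyCoupling μ ν γ)
    (f : Ed d → ℝ) (hf : Measurable f)
    (hfplus : Integrable (fun x => max (f x) 0) μ) :
    Integrable (fun p : Ed d × Ed d => max (f p.1) 0) γ ∧
    (∫⁻ p : Ed d × Ed d, ENNReal.ofReal (f p.1) ∂γ) = (∫⁻ x, ENNReal.ofReal (f x) ∂μ) ∧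
    (∫⁻ p : Ed d × Ed d, ENNReal.ofReal (-(f p.1)) ∂γ)
      = (∫⁻ x, ENNReal.ofReal (-(f x)) ∂μ) := by
  have h_map : γ.map Prod.fst = μ := hγ.map_fst hμ
  refine ⟨?_, ?_, ?_⟩
  · rw [← h_map] at hfplus
    exact hfplus.comp_measurable measurable_fst
  · rw [← h_map, lintegral_map hf.ennreal_ofReal measurable_fst]
  · rw [← h_map, lintegral_map (f := fun x => ENNReal.ofReal (-f x)) hf.neg.ennreal_ofReal measurable_fst]
end
end

section
/- Subadditivity and homogeneity of the Lévy transport cost: for all μ, μ', ν, ν' ∈ Λ(ℝ^d), C₂^Λ(μ+μ', ν+ν') ≤ C₂^Λ(μ,ν) + C₂^Λ(μ',ν'), and for every α ≥ 0, C₂^Λ(αμ, αν) = α · C₂^Λ(μ,ν). -/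
open MeasureTheory Filter Topology Set ENNReal

noncomputable section

section LevyCoupling

variable {E : Type*} [NormedAddCommGroup E] [MeasurableSpace E]

theorem IsLevyMeasure.zero : IsLevyMeasure (0 : Measure E) := by
  simp [IsLevyMeasure]

theorem IsLevyMeasure.add {μ ν : Measure E} (hμ : IsLevyMeasure μ) (hν : IsLevyMeasure ν) :
    IsLevyMeasure (μ + ν) := by
  refine ⟨by simp [hμ.1, hν.1], ?_⟩
  rw [lintegral_add_measure]
  exact ENNReal.add_ne_top.2 ⟨hμ.2, hν.2⟩

theorem IsLevyMeasure.smul {μ : Measure E} (hμ : IsLevyMeasure μ) {c : ℝ≥0∞} (hc : c ≠ ⊤) :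
    IsLevyMeasure (c • μ) := by
  refine ⟨by simp [hμ.1], ?_⟩
  rw [lintegral_smul_measure]
  exact ENNReal.mul_ne_top hc hμ.2

theorem IsLevyCoupling.zero : IsLevyCoupling (0 : Measure E) 0 0 :=
  ⟨.zero, fun _ _ _ => by simp⟩

theorem IsLevyCoupling.add {μ ν μ' ν' : Measure E} {γ γ' : Measure (E × E)}
    (h : IsLevyCoupling μ ν γ) (h' : IsLevyCoupling μ' ν' γ') :
    IsLevyCoupling (μ + μ') (ν + ν') (γ + γ') := by
  refine ⟨h.1.add h'.1, fun s hs h0 => ?_⟩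
  simp only [Measure.add_apply, (h.2 s hs h0).1, (h.2 s hs h0).2, (h'.2 s hs h0).1,
    (h'.2 s hs h0).2, and_self]

theorem IsLevyCoupling.smul {μ ν : Measure E} {γ : Measure (E × E)}
    (h : IsLevyCoupling μ ν γ) {c : ℝ≥0∞} (hc : c ≠ ⊤) :
    IsLevyCoupling (c • μ) (c • ν) (c • γ) := by
  refine ⟨h.1.smul hc, fun s hs h0 => ?_⟩
  simp only [Measure.smul_apply, (h.2 s hs h0).1, (h.2 s hs h0).2, and_self]

theorem levyTransportCost_le {μ ν : Measure E} {γ : Measure (E × E)}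
    (h : IsLevyCoupling μ ν γ) :
    levyTransportCost μ ν ≤ ∫⁻ p, ENNReal.ofReal (‖p.1 - p.2‖ ^ 2 / 2) ∂γ :=
  iInf₂_le γ h

theorem levyTransportCost_add_le (μ ν μ' ν' : Measure E) :
    levyTransportCost (μ + μ') (ν + ν') ≤ levyTransportCost μ ν + levyTransportCost μ' ν' := by
  refine ENNReal.le_iInf₂_add_iInf₂ fun γ h γ' h' => ?_
  rw [← lintegral_add_measure]
  exact levyTransportCost_le (h.add h')

theorem levyTransportCost_zero : levyTransportCost (0 : Measure E) 0 = 0 :=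
  le_antisymm ((levyTransportCost_le .zero).trans_eq (lintegral_zero_measure _)) zero_le

theorem levyTransportCost_smul_le (μ ν : Measure E) {c : ℝ≥0∞} (hc₀ : c ≠ 0) (hc : c ≠ ⊤) :
    levyTransportCost (c • μ) (c • ν) ≤ c * levyTransportCost μ ν := by
  conv_rhs => rw [levyTransportCost]
  simp only [ENNReal.mul_iInf_of_ne hc₀ hc]
  refine le_iInf₂ fun γ h => (levyTransportCost_le (h.smul hc)).trans_eq ?_
  rw [lintegral_smul_measure, smul_eq_mul]

theorem levyTransportCost_smul (μ ν : Measure E) {c : ℝ≥0∞} (hc : c ≠ ⊤) :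
    levyTransportCost (c • μ) (c • ν) = c * levyTransportCost μ ν := by
  rcases eq_or_ne c 0 with rfl | hc₀
  · simp [levyTransportCost_zero]
  refine le_antisymm (levyTransportCost_smul_le μ ν hc₀ hc) ?_
  have h := levyTransportCost_smul_le (c • μ) (c • ν)
    (ENNReal.inv_ne_zero.2 hc) (ENNReal.inv_ne_top.2 hc₀)
  simp only [smul_smul, ENNReal.inv_mul_cancel hc₀ hc, one_smul] at h
  calc c * levyTransportCost μ ν
      ≤ c * (c⁻¹ * levyTransportCost (c • μ) (c • ν)) := by gcongr
    _ = levyTransportCost (c • μ) (c • ν) := by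
      rw [← mul_assoc, ENNReal.mul_inv_cancel hc₀ hc, one_mul]

end LevyCoupling

/-- Subadditivity and nonnegative homogeneity of the Lévy transport
cost: `C₂^Λ(μ+μ', ν+ν') ≤ C₂^Λ(μ,ν) + C₂^Λ(μ',ν')` and
`C₂^Λ(αμ, αν) = α C₂^Λ(μ,ν)` for every `α ≥ 0`. -/
theorem levyTransportCost_subadd_and_homogeneous (d : ℕ)
    (μ μ' ν ν' : Measure (Ed d))
    (hμ : IsLevyMeasure μ) (hμ' : IsLevyMeasure μ')
    (hν : IsLevyMeasure ν) (hν' : IsLevyMeasure ν') :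
    levyTransportCost (μ + μ') (ν + ν') ≤ levyTransportCost μ ν + levyTransportCost μ' ν' ∧
    ∀ α : ℝ, 0 ≤ α →
      levyTransportCost (ENNReal.ofReal α • μ) (ENNReal.ofReal α • ν) =
        ENNReal.ofReal α * levyTransportCost μ ν :=
  ⟨levyTransportCost_add_le μ ν μ' ν',
    fun _ _ => levyTransportCost_smul μ ν ENNReal.ofReal_ne_top⟩
end
end

section
/- Tightness of coupling families: let M, N ⊆ Λ(ℝ^d) be two Λ-tight families of Lévy measures, and let Γ^Λ(M,N) := { γ ∈ Λ(ℝ^{2d}) : γ ∈ Γ^Λ(μ,ν) for some μ ∈ M, ν ∈ N } be the family of all Lévy couplings of pairs from M and N. Then Γ^Λ(M,N) is Λ-tight in Λ(ℝ^{2d}). -/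
open MeasureTheory Filter Topology Set ENNReal

noncomputable section

/-- Λ-tightness of a family of Lévy measures: uniformly bounded `min{1,‖x‖²}`-mass,
and uniformly small `min{1,‖x‖²}`-mass outside compact sets avoiding the origin. -/
def LevyTight {E : Type*} [NormedAddCommGroup E] [MeasurableSpace E]
    (M : Set (Measure E)) : Prop :=
  (⨆ μ ∈ M, ∫⁻ x, ENNReal.ofReal (min 1 (‖x‖ ^ 2)) ∂μ) ≠ ⊤ ∧
    ∀ ε : ℝ≥0∞, 0 < ε →
      ∃ K : Set E, IsCompact K ∧ (0 : E) ∉ K ∧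
        (⨆ μ ∈ M, ∫⁻ x in Kᶜ, ENNReal.ofReal (min 1 (‖x‖ ^ 2)) ∂μ) < ε

theorem lintegral_eq_of_forall_zero_notMem {E : Type*} [Zero E] [MeasurableSpace E]
    [MeasurableSingletonClass E] {μ ν : Measure E}
    (h : ∀ s, MeasurableSet s → (0 : E) ∉ s → μ s = ν s) {f : E → ℝ≥0∞} (hf : f 0 = 0) :
    ∫⁻ x, f x ∂μ = ∫⁻ x, f x ∂ν := by
  have hm : MeasurableSet ({0}ᶜ : Set E) := (measurableSet_singleton 0).compl
  have hr : μ.restrict {0}ᶜ = ν.restrict {0}ᶜ := by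
    ext s hs
    rw [Measure.restrict_apply hs, Measure.restrict_apply hs]
    exact h _ (hs.inter hm) (by simp)
  have hsupp : Function.support f ⊆ {0}ᶜ := by
    rintro x hx rfl
    exact hx hf
  rw [← setLIntegral_eq_of_support_subset (μ := μ) hsupp, hr,
    setLIntegral_eq_of_support_subset hsupp]

section IsLevyCoupling

variable {E : Type*} [NormedAddCommGroup E] [MeasurableSpace E] [BorelSpace E]
  {μ ν : Measure E} {γ : Measure (E × E)} {f : E → ℝ≥0∞}

theorem IsLevyCoupling.lintegral_fst (h : IsLevyCoupling μ ν γ) (hf : Measurable f)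
    (hf0 : f 0 = 0) : ∫⁻ p, f p.1 ∂γ = ∫⁻ x, f x ∂μ := by
  rw [← lintegral_map hf measurable_fst]
  refine lintegral_eq_of_forall_zero_notMem (fun s hs h0 ↦ ?_) hf0
  rw [Measure.map_apply measurable_fst hs, ← prod_univ]
  exact (h.2 s hs fun hn ↦ h0 (mem_of_mem_nhds hn)).1

theorem IsLevyCoupling.lintegral_snd (h : IsLevyCoupling μ ν γ) (hf : Measurable f)
    (hf0 : f 0 = 0) : ∫⁻ p, f p.2 ∂γ = ∫⁻ x, f x ∂ν := by
  rw [← lintegral_map hf measurable_snd]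
  refine lintegral_eq_of_forall_zero_notMem (fun s hs h0 ↦ ?_) hf0
  rw [Measure.map_apply measurable_snd hs, ← univ_prod]
  exact (h.2 s hs fun hn ↦ h0 (mem_of_mem_nhds hn)).2

/-- The cost of a Lévy coupling over pairs whose norm lies in `B` is controlled by the costs of the
marginals over points whose norm lies in `B`, as the norm of a pair is that of one coordinate. -/
theorem IsLevyCoupling.setLIntegral_norm_preimage_le [SecondCountableTopology E]
    (h : IsLevyCoupling μ ν γ) {B : Set ℝ} (hB : MeasurableSet B) :
    ∫⁻ p in norm ⁻¹' B, ENNReal.ofReal (min 1 (‖p‖ ^ 2)) ∂γ ≤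
      ∫⁻ x in norm ⁻¹' B, ENNReal.ofReal (min 1 (‖x‖ ^ 2)) ∂μ +
        ∫⁻ y in norm ⁻¹' B, ENNReal.ofReal (min 1 (‖y‖ ^ 2)) ∂ν := by
  set g : ℝ → ℝ≥0∞ := B.indicator fun t ↦ ENNReal.ofReal (min 1 (t ^ 2)) with hg
  have hgm : Measurable g := Measurable.indicator (by fun_prop) hB
  have hg0 : g ‖(0 : E)‖ = 0 := by simp [hg, indicator]
  have hgE : Measurable fun x : E ↦ g ‖x‖ := hgm.comp measurable_norm
  rw [← lintegral_indicator (measurable_norm hB), ← lintegral_indicator (measurable_norm hB),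
    ← lintegral_indicator (measurable_norm hB)]
  change ∫⁻ p, g ‖p‖ ∂γ ≤ ∫⁻ x, g ‖x‖ ∂μ + ∫⁻ y, g ‖y‖ ∂ν
  rw [← h.lintegral_fst hgE hg0, ← h.lintegral_snd hgE hg0,
    ← lintegral_add_left (by fun_prop)]
  refine lintegral_mono fun p ↦ ?_
  rcases max_choice ‖p.1‖ ‖p.2‖ with hp | hp <;> simp only [Prod.norm_def, hp]
  exacts [le_self_add, le_add_self]

end IsLevyCoupling

theorem IsCompact.exists_norm_subset_Icc {E : Type*} [NormedAddCommGroup E] {K : Set E}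
    (hK : IsCompact K) (h0 : (0 : E) ∉ K) : ∃ r R : ℝ, 0 < r ∧ K ⊆ norm ⁻¹' Icc r R := by
  obtain ⟨R, hR⟩ := hK.isBounded.exists_norm_le
  obtain ⟨r, hr, hrK⟩ := Metric.isOpen_iff.1 hK.isClosed.isOpen_compl 0 h0
  refine ⟨r, R, hr, fun x hx ↦ ⟨le_of_not_gt fun hlt ↦ ?_, hR x hx⟩⟩
  exact hrK (mem_ball_zero_iff.2 hlt) hx

/-- Couplings of Λ-tight families of measures on a proper normed group are Λ-tight. -/
theorem LevyTight.couplings {E : Type*} [NormedAddCommGroup E] [ProperSpace E]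
    [MeasurableSpace E] [BorelSpace E] {M N : Set (Measure E)}
    (hM : LevyTight M) (hN : LevyTight N) :
    LevyTight {γ : Measure (E × E) | ∃ μ ∈ M, ∃ ν ∈ N, IsLevyCoupling μ ν γ} := by
  refine ⟨ne_top_of_le_ne_top (ENNReal.add_ne_top.2 ⟨hM.1, hN.1⟩) ?_, fun ε hε ↦ ?_⟩
  · refine iSup₂_le fun γ ⟨μ, hμ, ν, hν, h⟩ ↦ ?_
    have hle := h.setLIntegral_norm_preimage_le MeasurableSet.univ
    simp only [preimage_univ, Measure.restrict_univ] at hle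
    exact hle.trans (add_le_add (le_iSup₂_of_le μ hμ le_rfl) (le_iSup₂_of_le ν hν le_rfl))
  · obtain ⟨K, hK, hK0, hKε⟩ := hM.2 (ε / 2) (ENNReal.half_pos hε.ne')
    obtain ⟨L, hL, hL0, hLε⟩ := hN.2 (ε / 2) (ENNReal.half_pos hε.ne')
    obtain ⟨r, R, hr, hKLr⟩ := (hK.union hL).exists_norm_subset_Icc (not_or.2 ⟨hK0, hL0⟩)
    refine ⟨norm ⁻¹' Icc r R, ?_, fun h ↦ hr.not_ge (by simpa using h.1), ?_⟩
    · refine (isCompact_closedBall (0 : E × E) R).of_isClosed_subset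
        (isClosed_Icc.preimage continuous_norm) fun p hp ↦ mem_closedBall_zero_iff.2 hp.2
    · refine lt_of_le_of_lt (iSup₂_le fun γ ⟨μ, hμ, ν, hν, h⟩ ↦ ?_)
        ((ENNReal.add_lt_add hKε hLε).trans_eq (ENNReal.add_halves ε))
      refine (h.setLIntegral_norm_preimage_le measurableSet_Icc.compl).trans (add_le_add ?_ ?_)
      · exact le_iSup₂_of_le μ hμ (lintegral_mono_set
          (compl_subset_compl.2 (subset_union_left.trans hKLr)))
      · exact le_iSup₂_of_le ν hν (lintegral_mono_set
          (compl_subset_compl.2 (subset_union_right.trans hKLr)))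

/-- If `M, N ⊆ Λ(ℝ^d)` are Λ-tight families of Lévy measures, then
the family of all Lévy couplings of pairs from `M` and `N` is Λ-tight in `Λ(ℝ^{2d})`. -/
theorem levyTight_couplings (d : ℕ) (M N : Set (Measure (Ed d)))
    (hM : ∀ μ ∈ M, IsLevyMeasure μ) (hN : ∀ ν ∈ N, IsLevyMeasure ν)
    (hMt : LevyTight M) (hNt : LevyTight N) :
    LevyTight {γ : Measure (Ed d × Ed d) | ∃ μ ∈ M, ∃ ν ∈ N, IsLevyCoupling μ ν γ} :=
  hMt.couplings hNt
end
end

section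
/- Prokhorov-type compactness for Lévy measures: every Λ-tight sequence {μ_n} ⊆ Λ(ℝ^d) admits a subsequence {μ_{n_k}} and a Lévy measure μ ∈ Λ(ℝ^d) such that μ_{n_k} → μ Λ-weakly. -/
open MeasureTheory Filter Topology Set ENNReal

noncomputable section

/-- Λ-weak convergence of Lévy measures: convergence of integrals against all bounded
continuous test functions `φ` with `|φ(x)| ≤ C min{1,‖x‖²}`. -/
def LevyWeakTendsto {E : Type*} [NormedAddCommGroup E] [MeasurableSpace E]
    (μs : ℕ → Measure E) (μ : Measure E) : Prop :=
  ∀ φ : E → ℝ, Continuous φ →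
    (∃ C : ℝ, 0 ≤ C ∧ ∀ x, |φ x| ≤ C * min 1 (‖x‖ ^ 2)) →
    Tendsto (fun n => ∫ x, φ x ∂μs n) atTop (𝓝 (∫ x, φ x ∂μ))

open TopologicalSpace
open scoped NNReal BoundedContinuousFunction

/-- **Prokhorov's theorem** for sequences of finite measures: a tight sequence with bounded masses
has a weakly convergent subsequence. -/
theorem FiniteMeasure.exists_tendsto_subseq_of_isTightMeasureSet {X : Type*} [TopologicalSpace X]
    [PseudoMetrizableSpace X] [T2Space X] [SeparableSpace X] [MeasurableSpace X] [BorelSpace X]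
    (ν : ℕ → FiniteMeasure X) (C : ℝ≥0) (hC : ∀ n, (ν n).mass ≤ C)
    (ht : IsTightMeasureSet (range fun n => (ν n : Measure X))) :
    ∃ φ : ℕ → ℕ, StrictMono φ ∧ ∃ ν' : FiniteMeasure X, Tendsto (ν ∘ φ) atTop (𝓝 ν') := by
  obtain ⟨m, -, φ, hφ, hm⟩ :=
    (isCompact_Icc (a := (0 : ℝ≥0)) (b := C)).tendsto_subseq (x := fun n => (ν n).mass)
      fun n => ⟨zero_le, hC n⟩
  rcases eq_or_ne m 0 with rfl | hm0
  · exact ⟨φ, hφ, 0, FiniteMeasure.tendsto_zero_of_tendsto_zero_mass hm⟩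
  have hmpos : 0 < m := pos_iff_ne_zero.2 hm0
  obtain ⟨c, hc0, hcm⟩ := exists_between hmpos
  obtain ⟨N, hN⟩ := eventually_atTop.1 (hm.eventually_const_lt hcm)
  have hmass (k : ℕ) : c < (ν (φ (k + N))).mass := hN _ (Nat.le_add_left _ _)
  have hne (k : ℕ) : ν (φ (k + N)) ≠ 0 :=
    (FiniteMeasure.mass_nonzero_iff _).1 (hc0.trans (hmass k)).ne'
  have : Nonempty X := by
    by_contra hX
    rw [not_nonempty_iff] at hX
    exact hne 0 (FiniteMeasure.eq_of_forall_apply_eq _ _ fun s _ => by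
      simp [Set.eq_empty_of_isEmpty s])
  set P : ℕ → ProbabilityMeasure X := fun k => (ν (φ (k + N))).normalize with hP
  have hPt : IsTightMeasureSet {((μ : ProbabilityMeasure X) : Measure X) | μ ∈ range P} := by
    rw [isTightMeasureSet_iff_exists_isCompact_measure_compl_le] at ht ⊢
    intro ε hε
    obtain ⟨K, hK, hKν⟩ := ht (c * ε) (ENNReal.mul_pos (by simpa using hc0.ne') hε.ne')
    refine ⟨K, hK, ?_⟩
    rintro _ ⟨_, ⟨k, rfl⟩, rfl⟩
    rw [hP, FiniteMeasure.toMeasure_normalize_eq_of_nonzero _ (hne k),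
      Measure.coe_nnreal_smul_apply, ENNReal.coe_inv (hc0.trans (hmass k)).ne']
    have hmne : ((ν (φ (k + N))).mass : ℝ≥0∞) ≠ 0 :=
      ENNReal.coe_ne_zero.2 (hc0.trans (hmass k)).ne'
    calc ((ν (φ (k + N))).mass : ℝ≥0∞)⁻¹ * (ν (φ (k + N)) : Measure X) Kᶜ
        ≤ ((ν (φ (k + N))).mass : ℝ≥0∞)⁻¹ * ((ν (φ (k + N))).mass * ε) := by
          gcongr
          refine (hKν _ ⟨_, rfl⟩).trans ?_
          gcongr
          exact (hmass k).le
      _ = ε := by rw [← mul_assoc, ENNReal.inv_mul_cancel hmne ENNReal.coe_ne_top, one_mul]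
  obtain ⟨Q, -, ψ, hψ, hQ⟩ := (isCompact_closure_of_isTightMeasureSet hPt).tendsto_subseq
    fun k => subset_closure (mem_range_self k)
  refine ⟨fun k => φ (ψ k + N), fun a b hab => hφ (Nat.add_lt_add_right (hψ hab) N),
    m • Q.toFiniteMeasure, ?_⟩
  have hmQ : (m • Q.toFiniteMeasure).mass = m := by
    rw [FiniteMeasure.mass, FiniteMeasure.smul_apply, ← FiniteMeasure.mass,
      ProbabilityMeasure.mass_toFiniteMeasure, smul_eq_mul, mul_one]
  have hmQ0 : m • Q.toFiniteMeasure ≠ 0 := by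
    rwa [← FiniteMeasure.mass_nonzero_iff, hmQ]
  have hnorm : (m • Q.toFiniteMeasure).normalize = Q := by
    refine ProbabilityMeasure.eq_of_forall_apply_eq _ _ fun s _ => ?_
    rw [FiniteMeasure.normalize_eq_of_nonzero _ hmQ0, hmQ, FiniteMeasure.smul_apply]
    simp [hm0]
  refine FiniteMeasure.tendsto_of_tendsto_normalize_testAgainstNN_of_tendsto_mass ?_ ?_
  · rw [hnorm]
    exact hQ
  · rw [hmQ]
    exact hm.comp ((tendsto_add_atTop_nat N).comp hψ.tendsto_atTop)

section LevyWeight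

variable {E : Type*} [NormedAddCommGroup E]

/-- The weight `min {1, ‖x‖²}` on the complement of the origin. -/
def levyWeight (x : ({0}ᶜ : Set E)) : ℝ≥0 := min 1 (‖(x : E)‖₊ ^ 2)

theorem levyWeight_ne_zero (x : ({0}ᶜ : Set E)) : levyWeight x ≠ 0 := by
  have hx : (x : E) ≠ 0 := x.2
  exact (lt_min one_pos (pow_pos (nnnorm_pos.2 hx) 2)).ne'

theorem continuous_levyWeight : Continuous (levyWeight (E := E)) := by
  unfold levyWeight
  fun_prop

theorem coe_levyWeight (x : ({0}ᶜ : Set E)) : (levyWeight x : ℝ) = min 1 (‖(x : E)‖ ^ 2) := by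
  simp [levyWeight]

theorem ennreal_coe_levyWeight (x : ({0}ᶜ : Set E)) :
    (levyWeight x : ℝ≥0∞) = ENNReal.ofReal (min 1 (‖(x : E)‖ ^ 2)) := by
  rw [← coe_levyWeight, ENNReal.ofReal_coe_nnreal]

variable [MeasurableSpace E]

/-- The finite measure `min {1, ‖x‖²} dμ` on the complement of the origin. -/
def levyWeighted (μ : Measure E) : Measure ({0}ᶜ : Set E) :=
  (μ.comap (↑)).withDensity fun x => levyWeight x

/-- The measure on the whole space whose weighted restriction to the complement of the origin
is `ν`. -/
def levyUnweighted (ν : Measure ({0}ᶜ : Set E)) : Measure E :=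
  (ν.withDensity fun x => ((levyWeight x)⁻¹ : ℝ≥0)).map (↑)

/-- The bounded continuous function `φ(x) / min {1, ‖x‖²}` on the complement of the origin. -/
def levyQuotient (φ : E → ℝ) (hφ : Continuous φ) (C : ℝ)
    (hC : ∀ x, |φ x| ≤ C * min 1 (‖x‖ ^ 2)) : ({0}ᶜ : Set E) →ᵇ ℝ :=
  BoundedContinuousFunction.ofNormedAddCommGroup (fun x => (levyWeight x)⁻¹ • φ x)
    ((continuous_levyWeight.inv₀ levyWeight_ne_zero).smul (hφ.comp continuous_subtype_val)) C
    fun x => by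
      have hx : (0 : ℝ) < levyWeight x := by
        exact_mod_cast pos_iff_ne_zero.2 (levyWeight_ne_zero x)
      rw [NNReal.smul_def, smul_eq_mul, norm_mul, Real.norm_eq_abs (φ x), NNReal.norm_eq,
        NNReal.coe_inv, inv_mul_le_iff₀ hx, mul_comm, coe_levyWeight]
      exact hC x

variable [BorelSpace E]

theorem levyWeighted_apply (μ : Measure E) {s : Set ({0}ᶜ : Set E)} (hs : MeasurableSet s) :
    levyWeighted μ s = ∫⁻ x in (↑) '' s, ENNReal.ofReal (min 1 (‖x‖ ^ 2)) ∂μ := by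
  rw [levyWeighted, withDensity_apply _ hs]
  simp_rw [ennreal_coe_levyWeight]
  exact setLIntegral_subtype (measurableSet_singleton 0).compl s
    fun x => ENNReal.ofReal (min 1 (‖x‖ ^ 2))

theorem integral_levyQuotient_levyWeighted {μ : Measure E} (hμ : μ {0} = 0) (φ : E → ℝ)
    (hφ : Continuous φ) (C : ℝ) (hC : ∀ x, |φ x| ≤ C * min 1 (‖x‖ ^ 2)) :
    ∫ x, levyQuotient φ hφ C hC x ∂levyWeighted μ = ∫ x, φ x ∂μ := by
  rw [levyWeighted, integral_withDensity_eq_integral_smul continuous_levyWeight.measurable]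
  simp only [levyQuotient, BoundedContinuousFunction.coe_ofNormedAddCommGroup,
    smul_inv_smul₀ (levyWeight_ne_zero _)]
  rw [integral_subtype_comap (measurableSet_singleton 0).compl,
    Measure.restrict_eq_self_of_ae_mem]
  exact compl_mem_ae_iff.2 hμ

theorem integral_levyUnweighted (ν : Measure ({0}ᶜ : Set E)) (φ : E → ℝ)
    (hφ : Continuous φ) (C : ℝ) (hC : ∀ x, |φ x| ≤ C * min 1 (‖x‖ ^ 2)) :
    ∫ x, φ x ∂levyUnweighted ν = ∫ x, levyQuotient φ hφ C hC x ∂ν := by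
  rw [levyUnweighted,
    (MeasurableEmbedding.subtype_coe (measurableSet_singleton 0).compl).integral_map,
    integral_withDensity_eq_integral_smul (f := fun x => (levyWeight x)⁻¹)
      (continuous_levyWeight.inv₀ levyWeight_ne_zero).measurable]
  rfl

theorem isLevyMeasure_levyUnweighted (ν : Measure ({0}ᶜ : Set E)) [IsFiniteMeasure ν] :
    IsLevyMeasure (levyUnweighted ν) := by
  have hemb := MeasurableEmbedding.subtype_coe (measurableSet_singleton (0 : E)).compl
  refine ⟨?_, ?_⟩
  · rw [levyUnweighted, hemb.map_apply]
    rw [show ((↑) ⁻¹' ({0} : Set E) : Set ({0}ᶜ : Set E)) = ∅ from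
      eq_empty_of_forall_notMem fun x hx => x.2 hx, measure_empty]
  · have hmeas : Measurable fun x : ({0}ᶜ : Set E) => (((levyWeight x)⁻¹ : ℝ≥0) : ℝ≥0∞) :=
      (continuous_levyWeight.inv₀ levyWeight_ne_zero).measurable.coe_nnreal_ennreal
    rw [levyUnweighted, hemb.lintegral_map]
    simp_rw [← ennreal_coe_levyWeight]
    rw [lintegral_withDensity_eq_lintegral_mul _ hmeas
      continuous_levyWeight.measurable.coe_nnreal_ennreal]
    simp only [Pi.mul_apply, ← ENNReal.coe_mul, inv_mul_cancel₀ (levyWeight_ne_zero _)]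
    simp

end LevyWeight

/-- **Prokhorov-type compactness.** Every Λ-tight sequence of Lévy
measures admits a subsequence converging Λ-weakly to some Lévy measure. -/
theorem levy_prokhorov (d : ℕ) (μs : ℕ → Measure (Ed d))
    (h : ∀ n, IsLevyMeasure (μs n)) (ht : LevyTight (Set.range μs)) :
    ∃ φ : ℕ → ℕ, StrictMono φ ∧
      ∃ μ : Measure (Ed d), IsLevyMeasure μ ∧ LevyWeakTendsto (fun k => μs (φ k)) μ := by
  obtain ⟨hbdd, htight⟩ := ht
  rw [iSup_range] at hbdd
  have hmass (n : ℕ) : levyWeighted (μs n) univ ≤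
      ⨆ n, ∫⁻ x, ENNReal.ofReal (min 1 (‖x‖ ^ 2)) ∂μs n := by
    rw [levyWeighted_apply _ MeasurableSet.univ]
    exact (setLIntegral_le_lintegral _ _).trans
      (le_iSup (fun n => ∫⁻ x, ENNReal.ofReal (min 1 (‖x‖ ^ 2)) ∂μs n) n)
  let ν (n : ℕ) : FiniteMeasure ({0}ᶜ : Set (Ed d)) :=
    ⟨levyWeighted (μs n), ⟨(hmass n).trans_lt hbdd.lt_top⟩⟩
  have hν : IsTightMeasureSet (range fun n => (ν n : Measure ({0}ᶜ : Set (Ed d)))) := by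
    rw [isTightMeasureSet_iff_exists_isCompact_measure_compl_le]
    intro ε hε
    obtain ⟨K, hK, hK0, hKε⟩ := htight ε hε
    rw [iSup_range] at hKε
    have hK' : IsCompact ((↑) ⁻¹' K : Set ({0}ᶜ : Set (Ed d))) := by
      refine Topology.IsInducing.subtypeVal.isCompact_preimage' hK ?_
      rw [Subtype.range_coe]
      exact subset_compl_singleton_iff.2 hK0
    refine ⟨_, hK', ?_⟩
    rintro _ ⟨n, rfl⟩
    change levyWeighted (μs n) _ ≤ ε
    rw [levyWeighted_apply _ hK'.measurableSet.compl]
    calc ∫⁻ x in (↑) '' ((↑) ⁻¹' K : Set ({0}ᶜ : Set (Ed d)))ᶜ,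
          ENNReal.ofReal (min 1 (‖x‖ ^ 2)) ∂μs n
        ≤ ∫⁻ x in Kᶜ, ENNReal.ofReal (min 1 (‖x‖ ^ 2)) ∂μs n :=
          lintegral_mono_set (image_subset_iff.2 subset_rfl)
      _ ≤ ⨆ n, ∫⁻ x in Kᶜ, ENNReal.ofReal (min 1 (‖x‖ ^ 2)) ∂μs n :=
          le_iSup (fun n => ∫⁻ x in Kᶜ, ENNReal.ofReal (min 1 (‖x‖ ^ 2)) ∂μs n) n
      _ ≤ ε := hKε.le
  obtain ⟨φ, hφ, ν', hν'⟩ := FiniteMeasure.exists_tendsto_subseq_of_isTightMeasureSet ν _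
    (fun n => ENNReal.toNNReal_mono hbdd (hmass n)) hν
  refine ⟨φ, hφ, levyUnweighted ν', isLevyMeasure_levyUnweighted _, ?_⟩
  rintro f hf ⟨C, -, hC⟩
  have hlim := FiniteMeasure.tendsto_iff_forall_integral_tendsto.1 hν' (levyQuotient f hf C hC)
  rw [← integral_levyUnweighted] at hlim
  exact hlim.congr fun k => integral_levyQuotient_levyWeighted (h (φ k)).1 f hf C hC
end
end

section
/- Portmanteau-type theorem for Λ-weak convergence: let {μ_n} ⊆ Λ(ℝ^d) and μ ∈ Λ(ℝ^d). The following are equivalent: (i) μ_n → μ Λ-weakly; (ii) for every lower semicontinuous φ : ℝ^d → ℝ with φ(x) ≥ −C min{1,|x|²} for some C ≥ 0, one has ∫ φ dμ ≤ liminf_n ∫ φ dμ_n; (iii) for every upper semicontinuous φ : ℝ^d → ℝ with φ(x) ≤ C min{1,|x|²} for some C ≥ 0, one has ∫ φ dμ ≥ limsup_n ∫ φ dμ_n. -/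
open MeasureTheory Filter Topology Set ENNReal

noncomputable section

/-- The extended (possibly infinite) integral of a real function, with values in
`EReal`: the integral of the positive part minus the integral of the negative part. -/
noncomputable def extIntegral {E : Type*} [MeasurableSpace E]
    (μ : Measure E) (φ : E → ℝ) : EReal :=
  ((∫⁻ x, ENNReal.ofReal (φ x) ∂μ : ℝ≥0∞) : EReal)
    - ((∫⁻ x, ENNReal.ofReal (-(φ x)) ∂μ : ℝ≥0∞) : EReal)

lemma continuous_min_one_norm_sq {E : Type*} [NormedAddCommGroup E] :
    Continuous fun x : E => min 1 (‖x‖ ^ 2) := by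
  fun_prop

lemma min_one_norm_sq_nonneg {E : Type*} [NormedAddCommGroup E] (x : E) :
    0 ≤ min 1 (‖x‖ ^ 2) := by
  positivity

section LevyWeakConvergence

variable {E : Type*} [NormedAddCommGroup E] [MeasurableSpace E]

lemma IsLevyMeasure.lintegral_ofReal_ne_top {μ : Measure E} (hμ : IsLevyMeasure μ) {φ : E → ℝ}
    {C : ℝ} (hC : 0 ≤ C) (hφ : ∀ x, φ x ≤ C * min 1 (‖x‖ ^ 2)) :
    (∫⁻ x, ENNReal.ofReal (φ x) ∂μ) ≠ ⊤ := by
  refine ne_top_of_le_ne_top (ENNReal.mul_ne_top (ENNReal.ofReal_ne_top (r := C)) hμ.2) ?_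
  rw [← lintegral_const_mul' _ _ ENNReal.ofReal_ne_top]
  refine lintegral_mono fun x => ?_
  rw [← ENNReal.ofReal_mul hC]
  exact ENNReal.ofReal_le_ofReal (hφ x)

lemma IsLevyMeasure.integrable {μ : Measure E} (hμ : IsLevyMeasure μ) {φ : E → ℝ}
    (hm : AEStronglyMeasurable φ μ) {C : ℝ} (hC : 0 ≤ C)
    (hφ : ∀ x, |φ x| ≤ C * min 1 (‖x‖ ^ 2)) : Integrable φ μ := by
  refine ⟨hm, ?_⟩
  rw [hasFiniteIntegral_iff_norm]
  exact (hμ.lintegral_ofReal_ne_top hC hφ).lt_top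

lemma extIntegral_eq_integral {E : Type*} [MeasurableSpace E] {μ : Measure E} {φ : E → ℝ}
    (hφ : Integrable φ μ) :
    extIntegral μ φ = ((∫ x, φ x ∂μ : ℝ) : EReal) := by
  rw [integral_eq_lintegral_pos_part_sub_lintegral_neg_part hφ, EReal.coe_sub, extIntegral,
    EReal.coe_ennreal_toReal hφ.lintegral_lt_top.ne,
    EReal.coe_ennreal_toReal (show Integrable (fun x => -φ x) μ from hφ.neg).lintegral_lt_top.ne]

lemma extIntegral_neg {E : Type*} [MeasurableSpace E] {μ : Measure E} {φ : E → ℝ}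
    (hφ : (∫⁻ x, ENNReal.ofReal (-(φ x)) ∂μ) ≠ ⊤) :
    extIntegral μ (-φ) = -extIntegral μ φ := by
  simp only [extIntegral, Pi.neg_apply, neg_neg]
  rw [EReal.neg_sub (Or.inl (EReal.coe_ennreal_ne_bot _)) (Or.inr (by simpa using hφ)),
    sub_eq_add_neg, add_comm]

lemma forall_le_liminf_iff_forall_limsup_le {μs : ℕ → Measure E} {μ : Measure E}
    (h : ∀ n, IsLevyMeasure (μs n)) (hμ : IsLevyMeasure μ) :
    (∀ φ : E → ℝ, LowerSemicontinuous φ →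
        (∃ C : ℝ, 0 ≤ C ∧ ∀ x, -(C * min 1 (‖x‖ ^ 2)) ≤ φ x) →
        extIntegral μ φ ≤ liminf (fun n => extIntegral (μs n) φ) atTop) ↔
      ∀ φ : E → ℝ, UpperSemicontinuous φ →
        (∃ C : ℝ, 0 ≤ C ∧ ∀ x, φ x ≤ C * min 1 (‖x‖ ^ 2)) →
        limsup (fun n => extIntegral (μs n) φ) atTop ≤ extIntegral μ φ := by
  have hneg : ∀ {φ : E → ℝ} {C : ℝ}, 0 ≤ C → (∀ x, -(C * min 1 (‖x‖ ^ 2)) ≤ φ x) →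
      ∀ ν : Measure E, IsLevyMeasure ν → extIntegral ν (-φ) = -extIntegral ν φ :=
    fun hC hb ν hν => extIntegral_neg (hν.lintegral_ofReal_ne_top hC fun x => neg_le.1 (hb x))
  constructor
  · rintro H φ hφ ⟨C, hC, hb⟩
    have hb' : ∀ x, -(C * min 1 (‖x‖ ^ 2)) ≤ (-φ) x := fun x => neg_le_neg (hb x)
    have h1 := H (-φ) hφ.neg ⟨C, hC, hb'⟩
    have hφn : ∀ ν : Measure E, IsLevyMeasure ν → extIntegral ν φ = -extIntegral ν (-φ) :=
      fun ν hν => by rw [← hneg hC hb' ν hν, neg_neg]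
    rw [hφn μ hμ]
    simp only [fun n => hφn (μs n) (h n)]
    exact EReal.limsup_neg.trans_le (EReal.neg_le_neg_iff.2 h1)
  · rintro H φ hφ ⟨C, hC, hb⟩
    have h1 := H (-φ) hφ.neg ⟨C, hC, fun x => neg_le.1 (hb x)⟩
    rw [hneg hC hb μ hμ] at h1
    simp only [fun n => hneg hC hb (μs n) (h n)] at h1
    exact EReal.neg_le_neg_iff.1 (EReal.limsup_neg.symm.trans_le h1)

lemma extIntegral_eq_lintegral_add_sub {E : Type*} [MeasurableSpace E] {μ : Measure E} {φ c : E → ℝ}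
    (hφ : Measurable φ) (hc : Measurable c) (hc0 : ∀ x, 0 ≤ c x) (hφc : ∀ x, -c x ≤ φ x)
    (hct : (∫⁻ x, ENNReal.ofReal (c x) ∂μ) ≠ ⊤) :
    extIntegral μ φ = ((∫⁻ x, ENNReal.ofReal (φ x + c x) ∂μ : ℝ≥0∞) : EReal)
      - ((∫⁻ x, ENNReal.ofReal (c x) ∂μ : ℝ≥0∞) : EReal) := by
  have hNt : (∫⁻ x, ENNReal.ofReal (-(φ x)) ∂μ) ≠ ⊤ :=
    ne_top_of_le_ne_top hct (lintegral_mono fun x =>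
      ENNReal.ofReal_le_ofReal (by linarith [hφc x]))
  have key : (∫⁻ x, ENNReal.ofReal (φ x) ∂μ) + (∫⁻ x, ENNReal.ofReal (c x) ∂μ)
      = (∫⁻ x, ENNReal.ofReal (φ x + c x) ∂μ) + (∫⁻ x, ENNReal.ofReal (-(φ x)) ∂μ) := by
    rw [← lintegral_add_right _ hc.ennreal_ofReal,
      ← lintegral_add_right _ (show Measurable fun x => -φ x from hφ.neg).ennreal_ofReal]
    refine lintegral_congr fun x => ?_
    have h1 := hφc x
    rcases le_total 0 (φ x) with h0 | h0
    · rw [ENNReal.ofReal_of_nonpos (p := -φ x) (by linarith), add_zero,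
        ENNReal.ofReal_add h0 (hc0 x)]
    · rw [ENNReal.ofReal_of_nonpos h0, zero_add, ← ENNReal.ofReal_add (by linarith) (by linarith)]
      congr 1
      ring
  unfold extIntegral
  generalize (∫⁻ x, ENNReal.ofReal (φ x) ∂μ) = P at *
  generalize (∫⁻ x, ENNReal.ofReal (c x) ∂μ) = c' at *
  generalize (∫⁻ x, ENNReal.ofReal (φ x + c x) ∂μ) = g at *
  generalize (∫⁻ x, ENNReal.ofReal (-(φ x)) ∂μ) = N at *
  lift c' to NNReal using hct
  lift N to NNReal using hNt
  induction P with
  | top =>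
    have hg : g = ⊤ := by
      by_contra hg
      exact ENNReal.add_ne_top.2 ⟨hg, ENNReal.coe_ne_top⟩ (by rw [← key, top_add])
    subst hg
    rfl
  | coe P =>
    have hg : g ≠ ⊤ := by
      rintro rfl
      rw [top_add] at key
      exact ENNReal.add_ne_top.2 ⟨ENNReal.coe_ne_top, ENNReal.coe_ne_top⟩ key
    lift g to NNReal using hg
    have key' : (P : ℝ) + c' = g + N := by exact_mod_cast key
    simp only [EReal.coe_nnreal_eq_coe_real]
    rw [← EReal.coe_sub, ← EReal.coe_sub, EReal.coe_eq_coe_iff]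
    linarith

variable [BorelSpace E] {μs : ℕ → Measure E} {μ : Measure E}

lemma LevyWeakTendsto.tendsto_lintegral (hw : LevyWeakTendsto μs μ)
    (h : ∀ n, IsLevyMeasure (μs n)) (hμ : IsLevyMeasure μ) {φ : E → ℝ} (hφ : Continuous φ)
    (h0 : ∀ x, 0 ≤ φ x) {C : ℝ} (hC : 0 ≤ C) (hb : ∀ x, φ x ≤ C * min 1 (‖x‖ ^ 2)) :
    Tendsto (fun n => ∫⁻ x, ENNReal.ofReal (φ x) ∂μs n) atTop
      (𝓝 (∫⁻ x, ENNReal.ofReal (φ x) ∂μ)) := by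
  have hb' : ∀ x, |φ x| ≤ C * min 1 (‖x‖ ^ 2) := fun x => by
    rw [abs_of_nonneg (h0 x)]
    exact hb x
  have key : ∀ ν : Measure E, IsLevyMeasure ν →
      ∫⁻ x, ENNReal.ofReal (φ x) ∂ν = ENNReal.ofReal (∫ x, φ x ∂ν) := fun ν hν =>
    (ofReal_integral_eq_lintegral_ofReal
      (hν.integrable hφ.measurable.aestronglyMeasurable hC hb') (Eventually.of_forall h0)).symm
  simp only [key μ hμ, fun n => key (μs n) (h n)]
  exact ENNReal.tendsto_ofReal (hw φ hφ ⟨C, hC, hb'⟩)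

/-- The measures weighted by `min {1, ‖x‖²}` satisfy the liminf inequality on open sets. -/
lemma LevyWeakTendsto.withDensity_isOpen_le_liminf (hw : LevyWeakTendsto μs μ)
    (h : ∀ n, IsLevyMeasure (μs n)) (hμ : IsLevyMeasure μ) {U : Set E} (hU : IsOpen U) :
    μ.withDensity (fun x => ENNReal.ofReal (min 1 (‖x‖ ^ 2))) U ≤ liminf (fun n =>
      (μs n).withDensity (fun x => ENNReal.ofReal (min 1 (‖x‖ ^ 2))) U) atTop := by
  have hF : IsClosed Uᶜ := hU.isClosed_compl
  set g : ℕ → E → ℝ := fun k x => (1 - (hF.apprSeq k x : ℝ)) * min 1 (‖x‖ ^ 2) with hg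
  have hle1 : ∀ k x, (hF.apprSeq k x : ℝ) ≤ 1 := fun k x => by
    exact_mod_cast HasOuterApproxClosed.apprSeq_apply_le_one hF k x
  have hgc : ∀ k, Continuous (g k) := fun k => by
    have : Continuous (hF.apprSeq k) := (hF.apprSeq k).continuous
    have h2 := continuous_min_one_norm_sq (E := E)
    fun_prop
  have hg0 : ∀ k x, 0 ≤ g k x := fun k x =>
    mul_nonneg (sub_nonneg.2 (hle1 k x)) (min_one_norm_sq_nonneg x)
  have hgb : ∀ k x, g k x ≤ 1 * min 1 (‖x‖ ^ 2) := fun k x =>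
    mul_le_mul_of_nonneg_right (sub_le_self _ (NNReal.coe_nonneg _)) (min_one_norm_sq_nonneg x)
  simp only [withDensity_apply _ hU.measurableSet, ← lintegral_indicator hU.measurableSet]
  have hstep : ∀ k, ∫⁻ x, ENNReal.ofReal (g k x) ∂μ ≤ liminf (fun n =>
      ∫⁻ x, U.indicator (fun x => ENNReal.ofReal (min 1 (‖x‖ ^ 2))) x ∂μs n) atTop := fun k => by
    rw [← (hw.tendsto_lintegral h hμ (hgc k) (hg0 k) zero_le_one (hgb k)).liminf_eq]
    refine liminf_le_liminf (Eventually.of_forall fun n => lintegral_mono fun x => ?_)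
    by_cases hx : x ∈ U
    · rw [indicator_of_mem hx]
      exact ENNReal.ofReal_le_ofReal (by simpa using hgb k x)
    · have : hF.apprSeq k x = 1 :=
        HasOuterApproxClosed.apprSeq_apply_eq_one hF k (mem_compl hx)
      simp [hg, this]
  calc ∫⁻ x, U.indicator (fun x => ENNReal.ofReal (min 1 (‖x‖ ^ 2))) x ∂μ
      ≤ ∫⁻ x, liminf (fun k => ENNReal.ofReal (g k x)) atTop ∂μ := by
        refine lintegral_mono fun x => ?_
        by_cases hx : x ∈ U
        · have h1 : Tendsto (fun k => (hF.apprSeq k x : ℝ)) atTop (𝓝 0) := by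
            have := tendsto_pi_nhds.1 (HasOuterApproxClosed.tendsto_apprSeq hF) x
            rw [indicator_of_notMem (by simpa using hx)] at this
            simpa using NNReal.tendsto_coe.2 this
          have h2 : Tendsto (fun k => g k x) atTop (𝓝 (min 1 (‖x‖ ^ 2))) := by
            simpa using (h1.const_sub 1).mul_const (min 1 (‖x‖ ^ 2))
          rw [(ENNReal.tendsto_ofReal h2).liminf_eq, indicator_of_mem hx]
        · rw [indicator_of_notMem hx]
          exact zero_le
    _ ≤ liminf (fun k => ∫⁻ x, ENNReal.ofReal (g k x) ∂μ) atTop :=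
        lintegral_liminf_le fun k => (hgc k).measurable.ennreal_ofReal
    _ ≤ _ := liminf_le_of_frequently_le' (Frequently.of_forall hstep)

lemma IsLevyMeasure.lintegral_ofReal_eq_withDensity (hμ : IsLevyMeasure μ) {φ : E → ℝ}
    (hφ : Measurable φ) :
    ∫⁻ x, ENNReal.ofReal (φ x) ∂μ = ∫⁻ x, ENNReal.ofReal (φ x / min 1 (‖x‖ ^ 2))
      ∂μ.withDensity (fun x => ENNReal.ofReal (min 1 (‖x‖ ^ 2))) := by
  have hm := (continuous_min_one_norm_sq (E := E)).measurable
  have hG : Measurable fun x => φ x / min 1 (‖x‖ ^ 2) := hφ.div hm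
  rw [lintegral_withDensity_eq_lintegral_mul _ hm.ennreal_ofReal hG.ennreal_ofReal]
  have h0 : ∀ᵐ x ∂μ, x ≠ 0 := by
    rw [ae_iff]
    simpa using hμ.1
  refine lintegral_congr_ae (h0.mono fun x hx => ?_)
  have hpos : 0 < min 1 (‖x‖ ^ 2) := by positivity
  simp only [Pi.mul_apply]
  rw [← ENNReal.ofReal_mul hpos.le, mul_div_cancel₀ _ hpos.ne']

lemma LevyWeakTendsto.lintegral_le_liminf (hw : LevyWeakTendsto μs μ)
    (h : ∀ n, IsLevyMeasure (μs n)) (hμ : IsLevyMeasure μ) {φ : E → ℝ}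
    (hφ : LowerSemicontinuous φ) (h0 : ∀ x, 0 ≤ φ x) :
    ∫⁻ x, ENNReal.ofReal (φ x) ∂μ ≤
      liminf (fun n => ∫⁻ x, ENNReal.ofReal (φ x) ∂μs n) atTop := by
  have hm := (continuous_min_one_norm_sq (E := E)).measurable
  have hG0 : ∀ x, 0 ≤ φ x / min 1 (‖x‖ ^ 2) := fun x =>
    div_nonneg (h0 x) (min_one_norm_sq_nonneg x)
  have hGm : Measurable fun x => φ x / min 1 (‖x‖ ^ 2) := hφ.measurable.div hm
  simp only [hμ.lintegral_ofReal_eq_withDensity hφ.measurable,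
    fun n => (h n).lintegral_ofReal_eq_withDensity hφ.measurable]
  simp_rw [lintegral_eq_lintegral_meas_lt _ (Eventually.of_forall hG0) hGm.aemeasurable]
  refine (setLIntegral_mono' measurableSet_Ioi fun t (ht : 0 < t) =>
    hw.withDensity_isOpen_le_liminf h hμ ?_).trans
    (lintegral_liminf_le fun n => Antitone.measurable fun s t hst =>
      measure_mono fun x hx => lt_of_le_of_lt hst hx)
  have hset : {x | t < φ x / min 1 (‖x‖ ^ 2)} =
      {0}ᶜ ∩ (fun x => φ x + -(t * min 1 (‖x‖ ^ 2))) ⁻¹' Ioi 0 := by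
    ext x
    by_cases hx : x = 0
    · simp [hx, ht.le]
    · have hpos : 0 < min 1 (‖x‖ ^ 2) := by positivity
      simp only [mem_ofPred_eq, lt_div_iff₀ hpos, mem_inter_iff, mem_compl_iff, mem_singleton_iff,
        hx, not_false_eq_true, true_and, mem_preimage, mem_Ioi]
      constructor <;> intro _ <;> linarith
  rw [hset]
  exact isOpen_compl_singleton.inter ((hφ.add (continuous_const.mul
    continuous_min_one_norm_sq).neg.lowerSemicontinuous).isOpen_preimage 0)

lemma LevyWeakTendsto.extIntegral_le_liminf (hw : LevyWeakTendsto μs μ)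
    (h : ∀ n, IsLevyMeasure (μs n)) (hμ : IsLevyMeasure μ) {φ : E → ℝ}
    (hφ : LowerSemicontinuous φ) {C : ℝ} (hC : 0 ≤ C)
    (hb : ∀ x, -(C * min 1 (‖x‖ ^ 2)) ≤ φ x) :
    extIntegral μ φ ≤ liminf (fun n => extIntegral (μs n) φ) atTop := by
  have hcc : Continuous fun x : E => C * min 1 (‖x‖ ^ 2) :=
    continuous_const.mul continuous_min_one_norm_sq
  have hc0 : ∀ x : E, 0 ≤ C * min 1 (‖x‖ ^ 2) := fun x => mul_nonneg hC (min_one_norm_sq_nonneg x)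
  have hext : ∀ ν : Measure E, IsLevyMeasure ν → _ := fun ν hν =>
    extIntegral_eq_lintegral_add_sub (μ := ν) hφ.measurable hcc.measurable hc0 hb
      (hν.lintegral_ofReal_ne_top hC fun _ => le_rfl)
  have h1 := hw.lintegral_le_liminf h hμ (hφ.add hcc.lowerSemicontinuous)
    fun x => by linarith [hb x]
  have h1' := EReal.coe_ennreal_le_coe_ennreal_iff.2 h1
  rw [Monotone.map_liminf_of_continuousAt (f := ((↑) : ℝ≥0∞ → EReal))
    (fun _ _ hab => EReal.coe_ennreal_le_coe_ennreal_iff.2 hab) _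
    continuous_coe_ennreal_ereal.continuousAt] at h1'
  have h2 := (continuous_neg.comp continuous_coe_ennreal_ereal).continuousAt.tendsto.comp
    (hw.tendsto_lintegral h hμ hcc hc0 hC fun _ => le_rfl)
  rw [hext μ hμ]
  simp only [fun n => hext (μs n) (h n), sub_eq_add_neg]
  exact (add_le_add h1' h2.liminf_eq.ge).trans EReal.le_liminf_add

lemma levyWeakTendsto_iff_extIntegral_le_liminf
    (h : ∀ n, IsLevyMeasure (μs n)) (hμ : IsLevyMeasure μ) :
    LevyWeakTendsto μs μ ↔
      ∀ φ : E → ℝ, LowerSemicontinuous φ →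
        (∃ C : ℝ, 0 ≤ C ∧ ∀ x, -(C * min 1 (‖x‖ ^ 2)) ≤ φ x) →
        extIntegral μ φ ≤ liminf (fun n => extIntegral (μs n) φ) atTop := by
  refine ⟨fun hw φ hφ ⟨C, hC, hb⟩ => hw.extIntegral_le_liminf h hμ hφ hC hb, ?_⟩
  rintro H φ hφ ⟨C, hC, hb⟩
  have hext : ∀ ν : Measure E, IsLevyMeasure ν → _ := fun ν hν =>
    extIntegral_eq_integral (hν.integrable hφ.measurable.aestronglyMeasurable hC hb)
  have hneg : ∀ ν : Measure E, IsLevyMeasure ν → extIntegral ν (-φ) = -extIntegral ν φ :=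
    fun ν hν => extIntegral_neg (hν.lintegral_ofReal_ne_top hC fun x =>
      (neg_le_abs _).trans (hb x))
  have h1 := H φ hφ.lowerSemicontinuous ⟨C, hC, fun x => (abs_le.1 (hb x)).1⟩
  have h2 := H (-φ) hφ.neg.lowerSemicontinuous
    ⟨C, hC, fun x => neg_le_neg (abs_le.1 (hb x)).2⟩
  rw [hneg μ hμ] at h2
  simp only [fun n => hneg (μs n) (h n)] at h2
  replace h2 : -extIntegral μ φ ≤ -limsup (fun n => extIntegral (μs n) φ) atTop :=
    h2.trans_eq EReal.liminf_neg
  have h3 := tendsto_of_le_liminf_of_limsup_le h1 (EReal.neg_le_neg_iff.1 h2)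
  rw [hext μ hμ] at h3
  simp only [fun n => hext (μs n) (h n)] at h3
  exact EReal.tendsto_coe.1 h3

end LevyWeakConvergence

/-- **Portmanteau for Λ-weak convergence.** Λ-weak convergence is
equivalent to the liminf inequality for lower semicontinuous test functions bounded
below by `-C min{1,‖x‖²}`, and to the limsup inequality for upper semicontinuous test
functions bounded above by `C min{1,‖x‖²}`. -/
theorem levy_portmanteau (d : ℕ) (μs : ℕ → Measure (Ed d)) (μ : Measure (Ed d))
    (h : ∀ n, IsLevyMeasure (μs n)) (hμ : IsLevyMeasure μ) :
    (LevyWeakTendsto μs μ ↔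
      ∀ φ : Ed d → ℝ, LowerSemicontinuous φ →
        (∃ C : ℝ, 0 ≤ C ∧ ∀ x, -(C * min 1 (‖x‖ ^ 2)) ≤ φ x) →
        extIntegral μ φ ≤ Filter.liminf (fun n => extIntegral (μs n) φ) atTop) ∧
    (LevyWeakTendsto μs μ ↔
      ∀ φ : Ed d → ℝ, UpperSemicontinuous φ →
        (∃ C : ℝ, 0 ≤ C ∧ ∀ x, φ x ≤ C * min 1 (‖x‖ ^ 2)) →
        Filter.limsup (fun n => extIntegral (μs n) φ) atTop ≤ extIntegral μ φ) := by
  have hlsc := levyWeakTendsto_iff_extIntegral_le_liminf h hμ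
  exact ⟨hlsc, hlsc.trans (forall_le_liminf_iff_forall_limsup_le h hμ)⟩
end
end

section
/- Lipschitz test functions suffice for Λ-weak convergence: for μ, μ_n ∈ Λ(ℝ^d), one has μ_n → μ Λ-weakly if and only if ∫ φ dμ_n → ∫ φ dμ holds for every bounded Lipschitz continuous φ : ℝ^d → ℝ satisfying, for some constant C ≥ 0, |φ(x)| ≤ C min{1,|x|²} for all x and |∇φ(x)| ≤ C|x| for Lebesgue-a.e. x. -/
open MeasureTheory Filter Topology Set ENNReal

noncomputable section

/-- Convergence of the integrals of all bounded Lipschitz functions implies weak convergence of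
finite measures. -/
theorem finiteMeasure_tendsto_of_forall_lipschitz_integral_tendsto {Ω : Type*}
    [MeasurableSpace Ω] [PseudoMetricSpace Ω] [OpensMeasurableSpace Ω] [Nonempty Ω]
    {νs : ℕ → FiniteMeasure Ω} {ν : FiniteMeasure Ω}
    (h : ∀ f : Ω → ℝ, (∃ C, ∀ x, |f x| ≤ C) → (∃ L, LipschitzWith L f) →
      Tendsto (fun n => ∫ x, f x ∂(νs n : Measure Ω)) atTop (𝓝 (∫ x, f x ∂(ν : Measure Ω)))) :
    Tendsto νs atTop (𝓝 ν) := by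
  have mass_eq : ∀ ρ : FiniteMeasure Ω, ∫ _, (1 : ℝ) ∂(ρ : Measure Ω) = (ρ.mass : ℝ) := by
    intro ρ
    rw [integral_const, smul_eq_mul, mul_one]
    rfl
  have hmass : Tendsto (fun n => (νs n).mass) atTop (𝓝 ν.mass) := by
    have := h (fun _ => 1) ⟨1, by simp⟩ ⟨0, LipschitzWith.const 1⟩
    simp only [mass_eq] at this
    exact_mod_cast this
  by_cases hν : ν = 0
  · subst hν
    exact FiniteMeasure.tendsto_zero_of_tendsto_zero_mass (by simpa using hmass)
  have hmν : ν.mass ≠ 0 := ν.mass_nonzero_iff.mpr hν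
  have hmass' : Tendsto (fun n => ((νs n).mass : ℝ)) atTop (𝓝 (ν.mass : ℝ)) := by
    exact_mod_cast hmass
  refine FiniteMeasure.tendsto_of_tendsto_normalize_testAgainstNN_of_tendsto_mass ?_ hmass
  rw [tendsto_iff_forall_lipschitz_integral_tendsto]
  rintro f ⟨C, hC⟩ hL
  have hbdd : ∃ C, ∀ x, |f x| ≤ C := by
    obtain ⟨x₀⟩ := ‹Nonempty Ω›
    refine ⟨C + |f x₀|, fun x => ?_⟩
    have := hC x x₀
    rw [Real.dist_eq] at this
    have := abs_sub_abs_le_abs_sub (f x) (f x₀)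
    linarith
  have integral_eq : ∀ ρ : FiniteMeasure Ω, ρ ≠ 0 →
      ∫ x, f x ∂(ρ.normalize : Measure Ω) = (ρ.mass : ℝ)⁻¹ * ∫ x, f x ∂(ρ : Measure Ω) := by
    intro ρ hρ
    rw [ρ.toMeasure_normalize_eq_of_nonzero hρ, integral_smul_nnreal_measure, NNReal.smul_def]
    simp
  have hev : ∀ᶠ n in atTop, νs n ≠ 0 := by
    filter_upwards [hmass.eventually_ne hmν] with n hn using (νs n).mass_nonzero_iff.mp hn
  rw [integral_eq ν hν]
  refine ((hmass'.inv₀ (by exact_mod_cast hmν)).mul (h f hbdd hL)).congr' ?_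
  filter_upwards [hev] with n hn using (integral_eq _ hn).symm

/-- Weak convergence of finite measures passes to integrals of bounded measurable functions whose
only possible discontinuity is a point which the limit measure does not charge. -/
theorem tendsto_integral_of_continuousOn_compl_singleton {Ω : Type*}
    [MeasurableSpace Ω] [MetricSpace Ω] [OpensMeasurableSpace Ω]
    {νs : ℕ → FiniteMeasure Ω} {ν : FiniteMeasure Ω} (hν : Tendsto νs atTop (𝓝 ν))
    {x₀ : Ω} (hx₀ : (ν : Measure Ω) {x₀} = 0) {f : Ω → ℝ} (hf : Measurable f)
    {C : ℝ} (hC : ∀ x, |f x| ≤ C) (hcont : ContinuousOn f {x₀}ᶜ) :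
    Tendsto (fun n => ∫ x, f x ∂(νs n : Measure Ω)) atTop (𝓝 (∫ x, f x ∂(ν : Measure Ω))) := by
  have hC0 : 0 ≤ C := (abs_nonneg _).trans (hC x₀)
  rw [FiniteMeasure.tendsto_iff_forall_integral_tendsto] at hν
  have hν' : ∀ g : Ω → ℝ, Continuous g → ∀ B, (∀ x, |g x| ≤ B) →
      Tendsto (fun n => ∫ x, g x ∂(νs n : Measure Ω)) atTop (𝓝 (∫ x, g x ∂(ν : Measure Ω))) :=
    fun g hg B hB => hν (BoundedContinuousFunction.ofNormedAddCommGroup g hg B hB)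
  let χ : ℕ → Ω → ℝ := fun k x => min 1 (k * dist x x₀)
  have χ_cont : ∀ k, Continuous (χ k) := fun k => by fun_prop
  have χ_nonneg : ∀ k x, 0 ≤ χ k x := fun k x => le_min zero_le_one (by positivity)
  have χ_le : ∀ k x, χ k x ≤ 1 := fun k x => min_le_left _ _
  have fχ_bdd : ∀ k x, |f x * χ k x| ≤ C := fun k x => by
    rw [abs_mul, abs_of_nonneg (χ_nonneg k x)]
    exact (mul_le_of_le_one_right (abs_nonneg _) (χ_le k x)).trans (hC x)
  have fχ_cont : ∀ k, Continuous fun x => f x * χ k x := fun k => by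
    rw [continuous_iff_continuousAt]
    intro x
    by_cases hx : x = x₀
    · subst hx
      have h0 : Tendsto (fun y => C * χ k y) (𝓝 x) (𝓝 0) := by
        have := ((χ_cont k).const_mul C).tendsto x
        simpa [χ] using this
      have : Tendsto (fun y => f y * χ k y) (𝓝 x) (𝓝 0) := by
        refine squeeze_zero_norm (fun y => ?_) h0
        rw [Real.norm_eq_abs, abs_mul, abs_of_nonneg (χ_nonneg k y)]
        exact mul_le_mul_of_nonneg_right (hC y) (χ_nonneg k y)
      simpa [ContinuousAt, χ] using this
    · exact (hcont.continuousAt (isOpen_compl_singleton.mem_nhds hx)).mul (χ_cont k).continuousAt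
  have one_sub_bdd : ∀ k x, |1 - χ k x| ≤ 1 := fun k x =>
    abs_le.mpr ⟨by linarith [χ_le k x], by linarith [χ_nonneg k x]⟩
  have integrable_of_bdd : ∀ (ρ : FiniteMeasure Ω) (g : Ω → ℝ), Measurable g → ∀ B,
      (∀ x, |g x| ≤ B) → Integrable g (ρ : Measure Ω) := fun ρ g hg B hB =>
    Integrable.of_bound hg.aestronglyMeasurable B (Eventually.of_forall hB)
  have cutoff_error : ∀ (ρ : FiniteMeasure Ω) k,
      |∫ x, f x ∂(ρ : Measure Ω) - ∫ x, f x * χ k x ∂(ρ : Measure Ω)|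
        ≤ C * ∫ x, (1 - χ k x) ∂(ρ : Measure Ω) := by
    intro ρ k
    rw [← integral_sub (integrable_of_bdd ρ f hf C hC)
      (integrable_of_bdd ρ _ (fχ_cont k).measurable C (fχ_bdd k)), ← integral_const_mul,
      ← Real.norm_eq_abs]
    refine norm_integral_le_of_norm_le ((integrable_of_bdd ρ _
      (continuous_const.sub (χ_cont k)).measurable 1 (one_sub_bdd k)).const_mul C)
      (Eventually.of_forall fun x => ?_)
    have h1 : 0 ≤ 1 - χ k x := by linarith [χ_le k x]
    rw [show f x - f x * χ k x = f x * (1 - χ k x) by ring, Real.norm_eq_abs, abs_mul,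
      abs_of_nonneg h1]
    exact mul_le_mul_of_nonneg_right (hC x) h1
  have cutoff_lim : Tendsto (fun k => C * ∫ x, (1 - χ k x) ∂(ν : Measure Ω)) atTop (𝓝 0) := by
    have : Tendsto (fun k => ∫ x, (1 - χ k x) ∂(ν : Measure Ω)) atTop
        (𝓝 (∫ _, (0 : ℝ) ∂(ν : Measure Ω))) := by
      refine tendsto_integral_of_dominated_convergence (fun _ => 1)
        (fun k => (continuous_const.sub (χ_cont k)).measurable.aestronglyMeasurable)
        (integrable_const _) (fun k => Eventually.of_forall (one_sub_bdd k)) ?_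
      have hae : ∀ᵐ x ∂(ν : Measure Ω), x ≠ x₀ := by
        simpa [ae_iff] using hx₀
      filter_upwards [hae] with x hx
      have hlim : Tendsto (fun k : ℕ => (k : ℝ) * dist x x₀) atTop atTop :=
        tendsto_natCast_atTop_atTop.atTop_mul_const (dist_pos.mpr hx)
      refine tendsto_const_nhds.congr' ?_
      filter_upwards [hlim.eventually_ge_atTop 1] with k hk
      simp [χ, min_eq_left hk]
    simpa using this.const_mul C
  rw [Metric.tendsto_nhds]
  intro ε hε
  obtain ⟨k, hk⟩ := (cutoff_lim.eventually_lt_const (show 0 < ε / 4 by positivity)).exists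
  have h1 := Metric.tendsto_nhds.mp (hν' _ (fχ_cont k) C (fχ_bdd k)) (ε / 4) (by positivity)
  have h2 := ((hν' _ (continuous_const.sub (χ_cont k)) 1
    (one_sub_bdd k)).const_mul C).eventually_lt_const hk
  filter_upwards [h1, h2] with n hn1 hn2
  change C * ∫ x, (1 - χ k x) ∂(νs n : Measure Ω) < ε / 4 at hn2
  rw [Real.dist_eq] at hn1 ⊢
  have e1 := abs_le.mp (cutoff_error (νs n) k)
  have e2 := abs_le.mp (cutoff_error ν k)
  have e3 := abs_lt.mp hn1
  rw [abs_lt]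
  constructor <;> linarith [e1.1, e1.2, e2.1, e2.2, e3.1, e3.2]

section LevyWeight

variable {E : Type*} [NormedAddCommGroup E]

theorem min_one_sq_eq {t : ℝ} (ht : 0 ≤ t) : min 1 (t ^ 2) = (min 1 t) ^ 2 := by
  rcases le_total 1 t with h | h
  · rw [min_eq_left h, min_eq_left (one_le_pow₀ h), one_pow]
  · rw [min_eq_right h, min_eq_right (pow_le_one₀ ht h)]

theorem min_one_sq_norm_le_norm (x : E) : min 1 (‖x‖ ^ 2) ≤ ‖x‖ := by
  rw [min_one_sq_eq (norm_nonneg x)]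
  have h0 : 0 ≤ min 1 ‖x‖ := le_min zero_le_one (norm_nonneg x)
  nlinarith [min_le_left 1 ‖x‖, min_le_right 1 ‖x‖]

theorem abs_min_one_sq_norm_sub_le (x y : E) :
    |min 1 (‖x‖ ^ 2) - min 1 (‖y‖ ^ 2)| ≤ (min 1 ‖x‖ + min 1 ‖y‖) * ‖x - y‖ := by
  rw [min_one_sq_eq (norm_nonneg x), min_one_sq_eq (norm_nonneg y), sq_sub_sq, abs_mul,
    abs_of_nonneg (add_nonneg (le_min zero_le_one (norm_nonneg x))
      (le_min zero_le_one (norm_nonneg y)))]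
  refine mul_le_mul_of_nonneg_left ?_ (add_nonneg (le_min zero_le_one (norm_nonneg x))
      (le_min zero_le_one (norm_nonneg y)))
  calc |min 1 ‖x‖ - min 1 ‖y‖| ≤ max |1 - 1| |‖x‖ - ‖y‖| := abs_min_sub_min_le_max _ _ _ _
    _ ≤ ‖x - y‖ := by simpa using abs_norm_sub_norm_le x y

variable {g : E → ℝ} {B : ℝ} {K : NNReal}

theorem abs_weighted_sub_le (hB : ∀ x, |g x| ≤ B) (hK : LipschitzWith K g) (x y : E) :
    |min 1 (‖y‖ ^ 2) * g y - min 1 (‖x‖ ^ 2) * g x|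
      ≤ (B * (min 1 ‖y‖ + min 1 ‖x‖) + K * min 1 (‖x‖ ^ 2)) * ‖y - x‖ := by
  have hw : 0 ≤ min 1 (‖x‖ ^ 2) := le_min zero_le_one (sq_nonneg _)
  have hB0 : 0 ≤ B := (abs_nonneg _).trans (hB 0)
  have hg : |g y - g x| ≤ K * ‖y - x‖ := by
    simpa [dist_eq_norm] using hK.dist_le_mul y x
  have key : |(min 1 (‖y‖ ^ 2) - min 1 (‖x‖ ^ 2)) * g y|
      ≤ (min 1 ‖y‖ + min 1 ‖x‖) * ‖y - x‖ * B := by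
    rw [abs_mul]
    exact mul_le_mul (abs_min_one_sq_norm_sub_le y x) (hB y) (abs_nonneg _)
      ((abs_nonneg _).trans (abs_min_one_sq_norm_sub_le y x))
  have key' : |min 1 (‖x‖ ^ 2) * (g y - g x)| ≤ min 1 (‖x‖ ^ 2) * (K * ‖y - x‖) := by
    rw [abs_mul, abs_of_nonneg hw]
    exact mul_le_mul_of_nonneg_left hg hw
  calc |min 1 (‖y‖ ^ 2) * g y - min 1 (‖x‖ ^ 2) * g x|
      = |(min 1 (‖y‖ ^ 2) - min 1 (‖x‖ ^ 2)) * g y + min 1 (‖x‖ ^ 2) * (g y - g x)| := by ring_nf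
    _ ≤ _ := abs_add_le _ _
    _ ≤ _ := add_le_add key key'
    _ = _ := by ring

theorem lipschitzWith_weighted (hB : ∀ x, |g x| ≤ B) (hK : LipschitzWith K g) :
    LipschitzWith (2 * B.toNNReal + K) fun x => min 1 (‖x‖ ^ 2) * g x := by
  have hB0 : 0 ≤ B := (abs_nonneg _).trans (hB 0)
  refine LipschitzWith.of_dist_le_mul fun y x => ?_
  rw [Real.dist_eq, dist_eq_norm]
  refine (abs_weighted_sub_le hB hK x y).trans (mul_le_mul_of_nonneg_right ?_ (norm_nonneg _))
  push_cast
  rw [Real.coe_toNNReal B hB0]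
  nlinarith [min_le_left 1 ‖x‖, min_le_left 1 ‖y‖,
    mul_le_of_le_one_right K.coe_nonneg (min_le_left 1 (‖x‖ ^ 2))]

theorem norm_fderiv_weighted_le [NormedSpace ℝ E] (hB : ∀ x, |g x| ≤ B)
    (hK : LipschitzWith K g) (x : E) :
    ‖fderiv ℝ (fun x => min 1 (‖x‖ ^ 2) * g x) x‖ ≤ (2 * B + K) * ‖x‖ := by
  have hB0 : 0 ≤ B := (abs_nonneg _).trans (hB 0)
  have hlim : Tendsto (fun ε : ℝ => B * (2 * ‖x‖ + ε) + K * ‖x‖) (𝓝[>] 0)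
      (𝓝 (B * (2 * ‖x‖ + 0) + K * ‖x‖)) :=
    (Continuous.tendsto (by fun_prop) 0).mono_left nhdsWithin_le_nhds
  rw [show (2 * B + K) * ‖x‖ = B * (2 * ‖x‖ + 0) + K * ‖x‖ by ring]
  refine ge_of_tendsto hlim ?_
  filter_upwards [self_mem_nhdsWithin] with ε hε
  have hε : 0 < ε := hε
  refine norm_fderiv_le_of_lip' ℝ (by positivity) ?_
  filter_upwards [(continuous_norm.tendsto x).eventually_lt_const
    (show ‖x‖ < ‖x‖ + ε by linarith)] with y hy
  rw [Real.norm_eq_abs]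
  refine (abs_weighted_sub_le hB hK x y).trans (mul_le_mul_of_nonneg_right ?_ (norm_nonneg _))
  refine add_le_add (mul_le_mul_of_nonneg_left ?_ hB0)
    (mul_le_mul_of_nonneg_left (min_one_sq_norm_le_norm x) K.coe_nonneg)
  linarith [min_le_right 1 ‖x‖, min_le_right 1 ‖y‖]

variable [MeasurableSpace E]

/-- The finite measure with density `min {1, ‖x‖²}` with respect to a Lévy measure. -/
def IsLevyMeasure.weighted {μ : Measure E} (h : IsLevyMeasure μ) : FiniteMeasure E :=
  ⟨μ.withDensity fun x => ENNReal.ofReal (min 1 (‖x‖ ^ 2)), isFiniteMeasure_withDensity h.2⟩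

theorem IsLevyMeasure.weighted_singleton_zero {μ : Measure E} (h : IsLevyMeasure μ) :
    (h.weighted : Measure E) {0} = 0 :=
  withDensity_absolutelyContinuous _ _ h.1

theorem IsLevyMeasure.integral_weighted [OpensMeasurableSpace E] {μ : Measure E}
    (h : IsLevyMeasure μ) (f : E → ℝ) :
    ∫ x, f x ∂(h.weighted : Measure E) = ∫ x, min 1 (‖x‖ ^ 2) * f x ∂μ := by
  have hmeas : Measurable fun x : E => ENNReal.ofReal (min 1 (‖x‖ ^ 2)) :=
    (Continuous.measurable (by fun_prop)).ennreal_ofReal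
  refine (integral_withDensity_eq_integral_toReal_smul hmeas
    (Eventually.of_forall fun _ => ENNReal.ofReal_lt_top) f).trans ?_
  refine integral_congr_ae (Eventually.of_forall fun x => ?_)
  simp only [smul_eq_mul]
  rw [ENNReal.toReal_ofReal (le_min zero_le_one (sq_nonneg _))]

end LevyWeight

/-- Lipschitz test functions suffice for Λ-weak convergence:
`μ_n → μ` Λ-weakly iff `∫ φ dμ_n → ∫ φ dμ` for every bounded Lipschitz `φ` with
`|φ(x)| ≤ C min{1,‖x‖²}` everywhere and `|∇φ(x)| ≤ C‖x‖` Lebesgue-a.e. -/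
theorem levyWeakTendsto_iff_lipschitz (d : ℕ)
    (μs : ℕ → Measure (Ed d)) (μ : Measure (Ed d))
    (h : ∀ n, IsLevyMeasure (μs n)) (hμ : IsLevyMeasure μ) :
    LevyWeakTendsto μs μ ↔
      ∀ φ : Ed d → ℝ, (∃ K : NNReal, LipschitzWith K φ) →
        (∃ C : ℝ, 0 ≤ C ∧ (∀ x, |φ x| ≤ C * min 1 (‖x‖ ^ 2)) ∧
          ∀ᵐ x ∂(volume : Measure (Ed d)), ‖fderiv ℝ φ x‖ ≤ C * ‖x‖) →
        Tendsto (fun n => ∫ x, φ x ∂μs n) atTop (𝓝 (∫ x, φ x ∂μ)) := by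
  constructor
  · rintro hw φ ⟨K, hK⟩ ⟨C, hC0, hC, -⟩
    exact hw φ hK.continuous ⟨C, hC0, hC⟩
  intro hlip φ hφ ⟨C, hC0, hC⟩
  have hweak : Tendsto (fun n => (h n).weighted) atTop (𝓝 hμ.weighted) := by
    refine finiteMeasure_tendsto_of_forall_lipschitz_integral_tendsto ?_
    rintro g ⟨B, hB⟩ ⟨K, hK⟩
    have hB0 : 0 ≤ B := (abs_nonneg _).trans (hB 0)
    simp only [IsLevyMeasure.integral_weighted]
    refine hlip _ ⟨_, lipschitzWith_weighted hB hK⟩ ⟨2 * B + K, by positivity, fun x => ?_,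
      Eventually.of_forall (norm_fderiv_weighted_le hB hK)⟩
    have hw : 0 ≤ min 1 (‖x‖ ^ 2) := le_min zero_le_one (sq_nonneg _)
    rw [abs_mul, abs_of_nonneg hw, mul_comm]
    exact mul_le_mul_of_nonneg_right (by linarith [hB x, K.coe_nonneg]) hw
  have hφ_eq : ∀ x, min 1 (‖x‖ ^ 2) * (φ x / min 1 (‖x‖ ^ 2)) = φ x := by
    intro x
    refine mul_div_cancel_of_imp' fun hx => ?_
    simpa [hx] using hC x
  have hwc : Continuous fun x : Ed d => min 1 (‖x‖ ^ 2) := by fun_prop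
  have key := tendsto_integral_of_continuousOn_compl_singleton hweak
    hμ.weighted_singleton_zero (f := fun x => φ x / min 1 (‖x‖ ^ 2)) (C := C)
    (hφ.measurable.div hwc.measurable) (fun x => ?_) ?_
  · simpa only [IsLevyMeasure.integral_weighted, hφ_eq] using key
  · have hw : 0 ≤ min 1 (‖x‖ ^ 2) := le_min zero_le_one (sq_nonneg _)
    rw [abs_div, abs_of_nonneg hw]
    exact div_le_of_le_mul₀ hw hC0 (hC x)
  · refine hφ.continuousOn.div hwc.continuousOn fun x hx => ?_
    have hx : 0 < ‖x‖ := norm_pos_iff.mpr hx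
    positivity
end
end

section
/- Infimal convolution preserves two-variable cost constraints: let χ, q : ℝ^d → [0,∞] and let φ, ψ : ℝ^d → ℝ satisfy φ(x) + ψ(y) ≤ q(x − y) for all x, y ∈ ℝ^d. Define φ̂ := χ □ φ, ψ̂ := χ □ ψ, and q̂ := q □ (χ □ χ˜), where χ˜(x) := χ(−x). Then φ̂(x) + ψ̂(y) ≤ q̂(x − y) for all x, y ∈ ℝ^d, the inequality being understood in the extended reals [−∞, ∞]. -/
noncomputable section

/-- The infimal convolution of two extended-real-valued functions:
`(f □ g)(x) := ⨅ z, f(z) + g(x − z)`, with values in `[-∞, ∞]`. -/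
noncomputable def infConv {E : Type*} [AddGroup E] (f g : E → EReal) : E → EReal :=
  fun x => ⨅ z : E, f z + g (x - z)

/-- Infimal convolution preserves two-variable cost constraints:
if `χ, q : ℝ^d → [0,∞]` and `φ, ψ : ℝ^d → ℝ` satisfy `φ(x) + ψ(y) ≤ q(x − y)` for all
`x, y`, then `φ̂ := χ □ φ`, `ψ̂ := χ □ ψ` and `q̂ := q □ (χ □ χ˜)` (with
`χ˜(x) := χ(−x)`) satisfy `φ̂(x) + ψ̂(y) ≤ q̂(x − y)` for all `x, y`, in the extended
reals. -/
theorem infConv_preserves_cost_constraint (d : ℕ)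
    (χ q : Ed d → EReal) (hχ : ∀ x, 0 ≤ χ x) (hq : ∀ x, 0 ≤ q x)
    (φ ψ : Ed d → ℝ)
    (hconstr : ∀ x y : Ed d, (φ x : EReal) + (ψ y : EReal) ≤ q (x - y)) :
    ∀ x y : Ed d,
      infConv χ (fun z => (φ z : EReal)) x + infConv χ (fun z => (ψ z : EReal)) y ≤
        infConv q (infConv χ (fun z => χ (-z))) (x - y) := by
  intro x y
  refine le_iInf fun z => ?_
  have key : ∀ w : Ed d,
      infConv χ (fun z => (φ z : EReal)) x + infConv χ (fun z => (ψ z : EReal)) y ≤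
        q z + (χ w + χ (-(x - y - z - w))) := by
    intro w
    have h₁ : infConv χ (fun z => (φ z : EReal)) x ≤ χ w + φ (x - w) := iInf_le _ w
    have h₂ : infConv χ (fun z => (ψ z : EReal)) y ≤
        χ (-(x - y - z - w)) + ψ (y - -(x - y - z - w)) := iInf_le _ _
    have h₃ := hconstr (x - w) (y - -(x - y - z - w))
    rw [show x - w - (y - -(x - y - z - w)) = z by abel] at h₃
    refine (add_le_add h₁ h₂).trans ?_
    rw [add_add_add_comm, add_comm]
    exact add_le_add_left h₃ _
  have hinf : 0 ≤ infConv χ (fun z => χ (-z)) (x - y - z) :=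
    le_iInf fun w => add_nonneg (hχ _) (hχ _)
  by_cases hz : q z = ⊤
  · rw [hz, EReal.top_add_of_ne_bot (ne_bot_of_le_ne_bot EReal.zero_ne_bot hinf)]
    exact le_top
  · have hz' : q z ≠ ⊥ := ne_bot_of_le_ne_bot EReal.zero_ne_bot (hq z)
    rw [add_comm (q z), ← EReal.sub_le_iff_le_add (.inl hz') (.inl hz)]
    refine le_iInf fun w => ?_
    rw [EReal.sub_le_iff_le_add (.inl hz') (.inl hz), add_comm _ (q z)]
    exact key w
end
end
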